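/- There is no finite group G with π_e(G) ⊆ {1,2,3,4,6} that has exactly four cyclic subgroups of order 6, say H_1, H_2, H_3, H_4, such that for some partition of them into two pairs, each pair intersects in a subgroup of order 3 (i.e., |H_i ∩ H_j| = 3 and |H_s ∩ H_t| = 3 with {i,j,s,t} = {1,2,3,4}). -/

import Mathlib

theorem aux_odd (K : Type*) [Group K] [Finite K] (h : 2 ∣ Nat.card K) :
    Odd ({t : K | orderOf t = 2}.ncard) := by
  classical
  have := Fintype.ofFinite K
  let f : Function.End K := fun t => t⁻¹
  have hf : f ^ 2 ^ 1 = 1 := by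
    funext t
    change (t⁻¹)⁻¹ = t
    simp
  have : Fact (Nat.Prime 2) := ⟨Nat.prime_two⟩
  have h1 := Equiv.Perm.card_fixedPoints_modEq hf
  have h2 : (Function.fixedPoints f) = insert 1 {t : K | orderOf t = 2} := by
    ext t
    simp only [Function.mem_fixedPoints, Function.IsFixedPt, Set.mem_insert_iff, Set.mem_setOf_eq]
    change t⁻¹ = t ↔ _
    rw [orderOf_eq_prime_iff, inv_eq_iff_mul_eq_one, ← sq]
    constructor
    · intro h
      by_cases ht : t = 1
      · exact Or.inl ht
      · exact Or.inr ⟨h, ht⟩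
    · rintro (rfl | h)
      · simp
      · exact h.1
  have h3 : (Function.fixedPoints f).ncard = {t : K | orderOf t = 2}.ncard + 1 := by
    rw [h2, Set.ncard_insert_of_notMem]
    simp
  rw [← Nat.card_eq_fintype_card, ← Nat.card_eq_fintype_card, Nat.card_coe_set_eq, h3] at h1
  rw [Nat.odd_iff]
  unfold Nat.ModEq at h1
  omega

theorem aux_odd' {G : Type*} [Group G] [Finite G] (x s : G) (hs : orderOf s = 2)
    (hc : Commute x s) : Odd ({t : G | orderOf t = 2 ∧ Commute x t}.ncard) := by
  let K := Subgroup.centralizer {x}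
  have hmem : ∀ t : G, t ∈ K ↔ Commute x t := by
    intro t
    rw [Subgroup.mem_centralizer_singleton_iff]
    exact ⟨fun h => h.symm, fun h => h.symm⟩
  have e : {t : G | orderOf t = 2 ∧ Commute x t}
      = Subtype.val '' {t : K | orderOf t = 2} := by
    ext t
    constructor
    · rintro ⟨h1, h2⟩
      refine ⟨⟨t, (hmem t).2 h2⟩, ?_, rfl⟩
      simpa using h1
    · rintro ⟨⟨u, hu⟩, h1, rfl⟩
      exact ⟨by simpa using h1, (hmem u).1 hu⟩
  rw [e, Set.ncard_image_of_injective _ Subtype.val_injective]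
  apply aux_odd
  have : orderOf (⟨s, (hmem s).2 hc⟩ : K) = 2 := by simpa using hs
  rw [← this]
  exact orderOf_dvd_natCard _

theorem aux_bij {G : Type*} [Group G] [Finite G] (x : G) (hx : orderOf x = 3) :
    {H : Subgroup G | (IsCyclic H ∧ Nat.card H = 6) ∧ x ∈ H} =
      (fun t => Subgroup.zpowers (x * t)) '' {t : G | orderOf t = 2 ∧ Commute x t} := by
  have hord : ∀ t : G, orderOf t = 2 → Commute x t → orderOf (x * t) = 6 := by
    intro t h1 h2
    rw [h2.orderOf_mul_eq_mul_orderOf_of_coprime (by rw [hx, h1]; norm_num), hx, h1]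
  have hx3 : x ^ 3 = 1 := by rw [← hx]; exact pow_orderOf_eq_one x
  ext H
  constructor
  · rintro ⟨⟨h1, h2⟩, h3⟩
    obtain ⟨g, rfl⟩ := (Subgroup.isCyclic_iff_exists_zpowers_eq_top H).1 h1
    rw [Nat.card_zpowers] at h2
    have ht : orderOf (g ^ 3) = 2 := by
      rw [orderOf_pow' g (by norm_num), h2]
      norm_num
    have hc : Commute x (g ^ 3) := by
      obtain ⟨k, rfl⟩ := Subgroup.mem_zpowers_iff.1 h3
      exact ((Commute.refl g).zpow_left k).pow_right 3
    refine ⟨g ^ 3, ⟨ht, hc⟩, ?_⟩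
    apply Subgroup.eq_of_le_of_card_ge
    · rw [Subgroup.zpowers_le]
      exact mul_mem h3 (pow_mem (Subgroup.mem_zpowers g) 3)
    · rw [Nat.card_zpowers, Nat.card_zpowers, h2, hord _ ht hc]
  · rintro ⟨t, ⟨h1, h2⟩, rfl⟩
    refine ⟨⟨inferInstance, ?_⟩, ?_⟩
    · rw [Nat.card_zpowers, hord t h1 h2]
    · have ht : t ^ 2 = 1 := by rw [← h1]; exact pow_orderOf_eq_one t
      have : (x * t) ^ 4 = x := by
        rw [h2.mul_pow, pow_succ x 3, hx3, show t ^ 4 = (t ^ 2) ^ 2 by rw [← pow_mul], ht]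
        simp
      have h4 := pow_mem (Subgroup.mem_zpowers (x * t)) 4
      rwa [this] at h4

theorem aux_inj {G : Type*} [Group G] [Finite G] (x : G) (hx : orderOf x = 3) :
    Set.InjOn (fun t => Subgroup.zpowers (x * t)) {t : G | orderOf t = 2 ∧ Commute x t} := by
  have hx3 : x ^ 3 = 1 := by rw [← hx]; exact pow_orderOf_eq_one x
  have hcube : ∀ t : G, orderOf t = 2 → Commute x t → (x * t) ^ 3 = t := by
    intro t h1 h2
    have ht : t ^ 2 = 1 := by rw [← h1]; exact pow_orderOf_eq_one t
    rw [h2.mul_pow, hx3, pow_succ t 2, ht]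
    simp
  rintro s ⟨hs, hsc⟩ t ⟨ht, htc⟩ h
  have hst : x * s ∈ Subgroup.zpowers (x * t) := by
    have h' : Subgroup.zpowers (x * s) = Subgroup.zpowers (x * t) := h
    rw [← h']; exact Subgroup.mem_zpowers _
  obtain ⟨k, hk⟩ := Subgroup.mem_zpowers_iff.1 hst
  have h1 : s = t ^ k := by
    rw [← hcube s hs hsc, ← hk, ← zpow_natCast, ← zpow_mul, mul_comm, zpow_mul, zpow_natCast,
      hcube t ht htc]
  have ht2 : t ^ (2 : ℤ) = 1 := by
    have : t ^ 2 = 1 := by rw [← ht]; exact pow_orderOf_eq_one t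
    exact_mod_cast this
  rcases Int.even_or_odd' k with ⟨c, rfl | rfl⟩
  · rw [zpow_mul, ht2, one_zpow] at h1
    rw [h1] at hs
    simp at hs
  · rw [zpow_add, zpow_mul, ht2, one_zpow] at h1
    simpa using h1

theorem aux_mem {G : Type*} [Group G] [Finite G] (H Q : Subgroup G) (hH : IsCyclic H)
    (hQ : Nat.card Q = 3) (hQH : Q ≤ H) (x : G) (hx : x ∈ H) (hx3 : x ^ 3 = 1) : x ∈ Q := by
  classical
  have := Fintype.ofFinite G
  have h1 := IsCyclic.card_pow_eq_one_le (α := H) (n := 3) (by norm_num)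
  have h2 : Nat.card (Q.subgroupOf H) = 3 := by
    rw [Nat.card_congr (Subgroup.subgroupOfEquivOfLe hQH).toEquiv, hQ]
  have h3 : ((Q.subgroupOf H : Set H).toFinset) ⊆ Finset.univ.filter (fun a : H => a ^ 3 = 1) := by
    intro a ha
    simp only [Set.mem_toFinset, SetLike.mem_coe] at ha
    simp only [Finset.mem_filter, Finset.mem_univ, true_and]
    have h6 := pow_card_eq_one' (x := (⟨a, ha⟩ : Q.subgroupOf H))
    rw [h2] at h6
    exact congrArg Subtype.val h6
  have h4 := Finset.eq_of_subset_of_card_le h3 (by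
    refine h1.trans ?_
    rw [Set.toFinset_card, ← Nat.card_eq_fintype_card]
    exact h2.ge)
  have h5 : (⟨x, hx⟩ : H) ∈ Finset.univ.filter (fun a : H => a ^ 3 = 1) := by
    simp only [Finset.mem_filter, Finset.mem_univ, true_and]
    exact Subtype.ext hx3
  rw [← h4] at h5
  simpa [Subgroup.mem_subgroupOf] using h5

/-- There is no finite group `G` with `π_e(G) ⊆ {1,2,3,4,6}` having exactly four cyclic
subgroups of order 6 `H₁, H₂, H₃, H₄` such that some partition of them into two pairs has
both pairs intersecting in subgroups of order 3. -/
theorem no_group_with_four_paired_cyclic_subgroups_of_order_six :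
    ∀ (G : Type) [Group G] [Finite G] (H₁ H₂ H₃ H₄ : Subgroup G),
      (∀ g : G, orderOf g ∈ ({1, 2, 3, 4, 6} : Set ℕ)) →
      H₁ ≠ H₂ → H₁ ≠ H₃ → H₁ ≠ H₄ → H₂ ≠ H₃ → H₂ ≠ H₄ → H₃ ≠ H₄ →
      {H : Subgroup G | IsCyclic H ∧ Nat.card H = 6} = {H₁, H₂, H₃, H₄} →
      Nat.card (H₁ ⊓ H₂ : Subgroup G) = 3 →
      Nat.card (H₃ ⊓ H₄ : Subgroup G) = 3 →
      False := by
  intro G _ _ H₁ H₂ H₃ H₄ _ h12 h13 h14 h23 h24 h34 hS h3 h3'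
  have hall : ∀ H : Subgroup G, (IsCyclic H ∧ Nat.card H = 6) ↔ H = H₁ ∨ H = H₂ ∨ H = H₃ ∨ H = H₄ := by
    intro H
    have := Set.ext_iff.1 hS H
    simpa using this
  have : Fact (Nat.Prime 3) := ⟨Nat.prime_three⟩
  obtain ⟨⟨x, hxm⟩, hx'⟩ := exists_prime_orderOf_dvd_card' (G := (H₁ ⊓ H₂ : Subgroup G)) 3 (by rw [h3])
  have hx : orderOf x = 3 := by simpa using hx'
  have hx3 : x ^ 3 = 1 := by rw [← hx]; exact pow_orderOf_eq_one x
  have hx1 : x ∈ H₁ := hxm.1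
  have hx2 : x ∈ H₂ := hxm.2
  have hbij := aux_bij x hx
  have hcard := Set.ncard_image_of_injOn (aux_inj x hx)
  rw [← hbij] at hcard
  have hH1 := (hall H₁).2 (Or.inl rfl)
  have hex : H₁ ∈ {H : Subgroup G | (IsCyclic H ∧ Nat.card H = 6) ∧ x ∈ H} := ⟨hH1, hx1⟩
  rw [hbij] at hex
  obtain ⟨s, ⟨hs, hsc⟩, -⟩ := hex
  have hodd := aux_odd' x s hs hsc
  rw [← hcard] at hodd
  have hH3 := (hall H₃).2 (by simp)
  have hH4 := (hall H₄).2 (by simp)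
  by_cases hx4 : x ∈ H₃ ⊓ H₄
  · have e : {H : Subgroup G | (IsCyclic H ∧ Nat.card H = 6) ∧ x ∈ H} = {H₁, H₂, H₃, H₄} := by
      ext H
      simp only [Set.mem_setOf_eq, hall, Set.mem_insert_iff, Set.mem_singleton_iff]
      constructor
      · exact fun h => h.1
      · intro h
        refine ⟨h, ?_⟩
        rcases h with rfl | rfl | rfl | rfl
        · exact hx1
        · exact hx2
        · exact hx4.1
        · exact hx4.2
    rw [e, Set.ncard_insert_of_notMem (by simp [*]), Set.ncard_insert_of_notMem (by simp [*]),
      Set.ncard_pair h34] at hodd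
    exact absurd hodd (by decide)
  · have n3 : x ∉ H₃ := fun h => hx4 (aux_mem H₃ _ hH3.1 h3' inf_le_left x h hx3)
    have n4 : x ∉ H₄ := fun h => hx4 (aux_mem H₄ _ hH4.1 h3' inf_le_right x h hx3)
    have e : {H : Subgroup G | (IsCyclic H ∧ Nat.card H = 6) ∧ x ∈ H} = {H₁, H₂} := by
      ext H
      simp only [Set.mem_setOf_eq, hall, Set.mem_insert_iff, Set.mem_singleton_iff]
      constructor
      · rintro ⟨rfl | rfl | rfl | rfl, h⟩
        · simp
        · simp
        · exact absurd h n3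
        · exact absurd h n4
      · rintro (rfl | rfl)
        · exact ⟨by simp, hx1⟩
        · exact ⟨by simp, hx2⟩
    rw [e, Set.ncard_pair h12] at hodd
    exact absurd hodd (by decide)
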